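/- arXiv:1909.05077 — 9 statements merged into one kernel-verified Lean document; each statement's English description precedes it below -/
import Mathlib

section
/- Let p, q ∈ ℂ[X]. There exists a ℂ-linear bijection φ : ℂ[X] → ℂ[X] satisfying φ((f∘p)·δ_p(g)·h) = (f∘q)·δ_q(g)·h for all f, g, h ∈ ℂ[X] if and only if p = q. (Two first order differential calculi Ω¹_p(ℂ[x]) and Ω¹_q(ℂ[x]) are isomorphic iff p(x) = q(x).) -/
open Polynomial

/-- The twisted derivative `δ_p` : the `ℂ`-linear map on `ℂ[X]` determined on the
monomial basis by `δ_p (X ^ n) = ∑_{i + j = n - 1} p ^ i * X ^ j` for `n ≥ 1`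
(and `δ_p 1 = 0`), extended linearly via `Polynomial.sum`. -/
noncomputable def deltaP (p f : Polynomial ℂ) : Polynomial ℂ :=
  f.sum fun n a => C a * ∑ i ∈ Finset.range n, p ^ i * X ^ (n - 1 - i)

/-- The first order differential calculi `Ω¹_p(ℂ[x])` and `Ω¹_q(ℂ[x])` are isomorphic
iff `p = q`: there is a `ℂ`-linear bijection `φ` with
`φ (f·dg·h) = f·d'g·h`, i.e. `φ ((f ∘ p) * δ_p g * h) = (f ∘ q) * δ_q g * h`
for all `f g h`, iff `p = q`. -/
theorem calculi_isomorphic_iff (p q : Polynomial ℂ) :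
    (∃ φ : Polynomial ℂ ≃ₗ[ℂ] Polynomial ℂ,
      ∀ f g h : Polynomial ℂ,
        φ (f.comp p * deltaP p g * h) = f.comp q * deltaP q g * h) ↔ p = q := by
  have hX : ∀ r : Polynomial ℂ, deltaP r X = 1 := by
    intro r
    unfold deltaP
    rw [Polynomial.sum_X_index] <;> simp
  constructor
  · rintro ⟨φ, hφ⟩
    have h1 := hφ 1 X p
    have h2 := hφ X X 1
    simp only [hX, one_comp, X_comp, one_mul, mul_one] at h1 h2
    exact h1.symm.trans h2
  · rintro rfl
    exact ⟨LinearEquiv.refl ℂ _, fun f g h => rfl⟩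
end

section
/- Let F be a field, A an associative unital F-algebra, n ∈ ℕ, x : Fin n → A, T : A → Matrix (Fin n) (Fin n) A a function, and ∂ : Fin n → (A →ₗ[F] A) a family of F-linear maps such that (i) ∂_k(x_i) = 1 if i = k and ∂_k(x_i) = 0 if i ≠ k, and (ii) ∂_k(f·g) = ∂_k(f)·g + Σ_i (T f)_{k,i} · ∂_i(g) for all k and all f, g ∈ A. Then T is multiplicative: for all f, g ∈ A and all indices k, l, (T(f·g))_{k,l} = Σ_i (T f)_{k,i} · (T g)_{i,l}, i.e. T(fg) = T(f)·T(g) as matrices over A. -/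
/-- If the linear maps `∂ k : A → A` satisfy `∂ k (x i) = δ_{ik}` and the twisted
Leibniz rule `∂ k (f·g) = ∂ k f · g + ∑ i, (T f)ₖᵢ · ∂ i g`, then the twist `T`
is multiplicative: `T (f·g) = T f · T g` as matrices over `A`. -/
theorem twist_is_multiplicative {F : Type*} [Field F] {A : Type*} [Ring A] [Algebra F A]
    {n : ℕ} (x : Fin n → A) (T : A → Matrix (Fin n) (Fin n) A)
    (D : Fin n → (A →ₗ[F] A))
    (hD1 : ∀ i k : Fin n, D k (x i) = if i = k then 1 else 0)
    (hD2 : ∀ (k : Fin n) (f g : A),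
      D k (f * g) = D k f * g + ∑ i, T f k i * D i g)
    (f g : A) (k l : Fin n) :
    T (f * g) k l = ∑ i, T f k i * T g i l := by
  have key : ∀ (h : A) (k : Fin n), D k (h * x l) = D k h * x l + T h k l := by
    intro h k
    rw [hD2]
    simp [hD1]
  have h1 := key (f * g) k
  rw [mul_assoc, hD2 k f (g * x l), hD2 k f g] at h1
  simp only [key, mul_add, Finset.sum_add_distrib, add_mul, Finset.sum_mul, ← mul_assoc] at h1
  rw [← add_assoc] at h1
  exact (add_left_cancel h1).symm
end

section
/- Let A, B ∈ M₂(ℂ) and let T₁ = L(A,B) ∈ M₂(F). Then every entry of the matrix T₁·T₁ lies in the Grassmann ideal I if and only if A·B = B·A. -/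
noncomputable section

/-- The free associative `ℂ`-algebra on two generators. -/
abbrev F2 : Type := FreeAlgebra ℂ (Fin 2)

/-- The generator `x`. -/
def xg : F2 := FreeAlgebra.ι ℂ 0

/-- The generator `y`. -/
def yg : F2 := FreeAlgebra.ι ℂ 1

/-- The two-sided ideal of Grassmann relations `x², y², xy + yx`. -/
def grassmannIdeal : TwoSidedIdeal F2 :=
  TwoSidedIdeal.span {xg * xg, yg * yg, xg * yg + yg * xg}

/-- `L A B` is the matrix of linear forms whose `(i,j)` entry is `A i j • x + B i j • y`. -/
def L (A B : Matrix (Fin 2) (Fin 2) ℂ) : Matrix (Fin 2) (Fin 2) F2 :=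
  fun i j => A i j • xg + B i j • yg

/-- Left multiplication by `x` on the Grassmann algebra. -/
def mX : Matrix (Fin 4) (Fin 4) ℂ := !![0,0,0,0; 1,0,0,0; 0,0,0,0; 0,0,1,0]

/-- Left multiplication by `y` on the Grassmann algebra. -/
def mY : Matrix (Fin 4) (Fin 4) ℂ := !![0,0,0,0; 0,0,0,0; 1,0,0,0; 0,-1,0,0]

/-- The regular representation. -/
def rep : F2 →ₐ[ℂ] Matrix (Fin 4) (Fin 4) ℂ := FreeAlgebra.lift ℂ ![mX, mY]

lemma rep_x : rep xg = mX := by simp [rep, xg]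
lemma rep_y : rep yg = mY := by simp [rep, yg]

lemma mXX : mX * mX = 0 := by
  ext i j; fin_cases i <;> fin_cases j <;> simp [mX, Matrix.mul_apply, Fin.sum_univ_four]
lemma mYY : mY * mY = 0 := by
  ext i j; fin_cases i <;> fin_cases j <;> simp [mY, Matrix.mul_apply, Fin.sum_univ_four]
lemma mXY : mX * mY + mY * mX = 0 := by
  ext i j; fin_cases i <;> fin_cases j <;> simp [mX, mY, Matrix.mul_apply, Fin.sum_univ_four]
lemma mYX : (mY * mX) 3 0 = -1 := by
  simp [mX, mY, Matrix.mul_apply, Fin.sum_univ_four]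

lemma rep_eq_zero {a : F2} (h : a ∈ grassmannIdeal) : rep a = 0 := by
  have hle : grassmannIdeal ≤ TwoSidedIdeal.ker rep := by
    refine TwoSidedIdeal.span_le.2 ?_
    rintro z (rfl | rfl | rfl) <;>
      simp [TwoSidedIdeal.mem_ker, rep_x, rep_y, mXX, mYY, mXY]
  exact (TwoSidedIdeal.mem_ker _).1 (hle h)

lemma smul_mem_gr (c : ℂ) {a : F2} (h : a ∈ grassmannIdeal) : c • a ∈ grassmannIdeal := by
  rw [Algebra.smul_def]
  exact grassmannIdeal.mul_mem_left _ _ h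

lemma entry (A B : Matrix (Fin 2) (Fin 2) ℂ) (i j : Fin 2) :
    (L A B * L A B) i j = (A * A) i j • (xg * xg) + (B * B) i j • (yg * yg)
      + (A * B) i j • (xg * yg + yg * xg) + (B * A - A * B) i j • (yg * xg) := by
  simp only [Matrix.mul_apply, Fin.sum_univ_two, L, Matrix.sub_apply, add_mul, mul_add,
    smul_mul_smul_comm]
  module

lemma rels : xg * xg ∈ grassmannIdeal ∧ yg * yg ∈ grassmannIdeal ∧
    xg * yg + yg * xg ∈ grassmannIdeal := by
  refine ⟨?_, ?_, ?_⟩ <;> exact TwoSidedIdeal.subset_span (by simp)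

/-- Every entry of `T₁ · T₁`, where `T₁ = L A B`, lies in the Grassmann ideal
iff `A·B = B·A`. -/
theorem sq_entries_mem_grassmannIdeal_iff (A B : Matrix (Fin 2) (Fin 2) ℂ) :
    (∀ i j, (L A B * L A B) i j ∈ grassmannIdeal) ↔ A * B = B * A := by
  obtain ⟨h1, h2, h3⟩ := rels
  constructor
  · intro h
    ext i j
    have := rep_eq_zero (h i j)
    rw [entry] at this
    simp only [map_add, map_smul, map_mul, rep_x, rep_y, mXX, mYY, mXY, smul_zero, zero_add]
      at this
    have h4 := congrFun (congrFun this 3) 0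
    rw [Matrix.smul_apply, mYX] at h4
    simp only [Matrix.sub_apply, Matrix.zero_apply, smul_eq_mul] at h4
    linear_combination h4
  · intro h i j
    rw [entry, h, sub_self, Matrix.zero_apply, zero_smul, add_zero]
    exact add_mem (add_mem (smul_mem_gr _ h1) (smul_mem_gr _ h2)) (smul_mem_gr _ h3)
end
end

section
/- Let A, B, C, D ∈ M₂(ℂ), T₁ = L(A,B) and T₂ = L(C,D) in M₂(F). Then every entry of the matrix T₁·T₂ + T₂·T₁ lies in the Grassmann ideal I if and only if A·D − D·A = B·C − C·B. -/
noncomputable section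

def gX : Matrix (Fin 4) (Fin 4) ℂ := !![0,0,0,0; 1,0,0,0; 0,0,0,0; 0,0,1,0]
def gY : Matrix (Fin 4) (Fin 4) ℂ := !![0,0,0,0; 0,0,0,0; 1,0,0,0; 0,-1,0,0]

def gphi : F2 →ₐ[ℂ] Matrix (Fin 4) (Fin 4) ℂ := FreeAlgebra.lift ℂ ![gX, gY]

lemma gphi_x : gphi xg = gX := by simp [gphi, xg]
lemma gphi_y : gphi yg = gY := by simp [gphi, yg]

lemma gXX : gX * gX = 0 := by
  ext i j; fin_cases i <;> fin_cases j <;> simp [gX, Matrix.mul_apply, Fin.sum_univ_four]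
lemma gYY : gY * gY = 0 := by
  ext i j; fin_cases i <;> fin_cases j <;> simp [gY, Matrix.mul_apply, Fin.sum_univ_four]
lemma gYX : gX * gY + gY * gX = 0 := by
  ext i j; fin_cases i <;> fin_cases j <;> simp [gX, gY, Matrix.mul_apply, Fin.sum_univ_four]
lemma gXY : (gX * gY) 3 0 = 1 := by
  simp [gX, gY, Matrix.mul_apply, Fin.sum_univ_four]

lemma gphi_mem {f : F2} (hf : f ∈ grassmannIdeal) : gphi f = 0 := by
  have h : grassmannIdeal ≤ TwoSidedIdeal.ker gphi := by
    refine TwoSidedIdeal.span_le.2 ?_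
    rintro z (rfl | rfl | rfl)
    · simp [TwoSidedIdeal.mem_ker, gphi_x, gXX]
    · simp [TwoSidedIdeal.mem_ker, gphi_y, gYY]
    · simp [TwoSidedIdeal.mem_ker, gphi_x, gphi_y, gYX]
  exact (TwoSidedIdeal.mem_ker gphi).1 (h hf)

lemma g_smul_mem (c : ℂ) {f : F2} (hf : f ∈ grassmannIdeal) : c • f ∈ grassmannIdeal := by
  rw [Algebra.smul_def]
  exact TwoSidedIdeal.mul_mem_left _ _ _ hf

lemma g_mem_iff (p q r s : ℂ) :
    p • (xg * xg) + q • (yg * yg) + r • (xg * yg + yg * xg) + s • (xg * yg) ∈ grassmannIdeal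
      ↔ s = 0 := by
  constructor
  · intro h
    have h2 := gphi_mem h
    simp only [map_add, map_smul, map_mul, gphi_x, gphi_y, gXX, gYY, gYX, smul_zero, zero_add] at h2
    have h3 := congrFun (congrFun h2 3) 0
    simpa [gXY] using h3
  · rintro rfl
    rw [zero_smul, add_zero]
    refine add_mem (add_mem ?_ ?_) ?_ <;> apply g_smul_mem <;>
      exact TwoSidedIdeal.subset_span (by simp)

/-- Every entry of `T₁·T₂ + T₂·T₁`, where `T₁ = L A B` and `T₂ = L C D`, lies in the
Grassmann ideal iff `A·D − D·A = B·C − C·B`. -/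
theorem anticommutator_entries_mem_grassmannIdeal_iff
    (A B C D : Matrix (Fin 2) (Fin 2) ℂ) :
    (∀ i j, (L A B * L C D + L C D * L A B) i j ∈ grassmannIdeal) ↔
      A * D - D * A = B * C - C * B := by
  rw [← sub_eq_zero, ← Matrix.ext_iff]
  refine forall_congr' fun i => forall_congr' fun j => ?_
  have key : (L A B * L C D + L C D * L A B) i j =
      ((A * C + C * A) i j) • (xg * xg) + ((B * D + D * B) i j) • (yg * yg)
      + ((B * C + D * A) i j) • (xg * yg + yg * xg)
      + ((A * D - D * A - (B * C - C * B)) i j) • (xg * yg) := by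
    simp only [L, Matrix.add_apply, Matrix.sub_apply, Matrix.mul_apply, Fin.sum_univ_two,
      add_mul, mul_add, smul_mul_smul_comm]
    module
  rw [key, g_mem_iff, Matrix.zero_apply]
end
end

section
/- Let c₁₁, c₂₁, b₁₂, b₂₂ ∈ ℂ and define A = [[−1, −c₁₁],[0, −1−c₂₁]], B = [[0, b₁₂],[0, b₂₂]], C = [[c₁₁, 0],[c₂₁, 0]], D = [[−1−b₁₂, 0],[−b₂₂, −1]] in M₂(ℂ). Then each of the three conditions A·B = B·A, C·D = D·C, and A·D − D·A = B·C − C·B is equivalent to the single condition c₁₁·b₂₂ = c₂₁·b₁₂, i.e. to det [[c₁₁, b₁₂],[c₂₁, b₂₂]] = 0. -/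
/-- For the matrices `A = [[−1, −c₁₁],[0, −1−c₂₁]]`, `B = [[0, b₁₂],[0, b₂₂]]`,
`C = [[c₁₁, 0],[c₂₁, 0]]`, `D = [[−1−b₁₂, 0],[−b₂₂, −1]]` parametrizing homogeneous
first order coordinate differential calculi on the 2-generated Grassmann algebra,
each of the conditions `A·B = B·A`, `C·D = D·C`, `A·D − D·A = B·C − C·B` is
equivalent to `c₁₁·b₂₂ = c₂₁·b₁₂`, i.e. to `det [[c₁₁,b₁₂],[c₂₁,b₂₂]] = 0`. -/
theorem grassmann_consistency_conditions (c11 c21 b12 b22 : ℂ) :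
    let A : Matrix (Fin 2) (Fin 2) ℂ := !![-1, -c11; 0, -1 - c21]
    let B : Matrix (Fin 2) (Fin 2) ℂ := !![0, b12; 0, b22]
    let C : Matrix (Fin 2) (Fin 2) ℂ := !![c11, 0; c21, 0]
    let D : Matrix (Fin 2) (Fin 2) ℂ := !![-1 - b12, 0; -b22, -1]
    (A * B = B * A ↔ c11 * b22 = c21 * b12) ∧
    (C * D = D * C ↔ c11 * b22 = c21 * b12) ∧
    (A * D - D * A = B * C - C * B ↔ c11 * b22 = c21 * b12) ∧
    (c11 * b22 = c21 * b12 ↔ (!![c11, b12; c21, b22] : Matrix (Fin 2) (Fin 2) ℂ).det = 0) := by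
  intro A B C D
  refine ⟨⟨fun h => ?_, fun h => ?_⟩, ⟨fun h => ?_, fun h => ?_⟩, ⟨fun h => ?_, fun h => ?_⟩, ?_⟩
  · have h1 := congrFun (congrFun h 0) 1
    simp [A, B, Matrix.mul_apply, Fin.sum_univ_two] at h1
    linear_combination -h1
  · ext i j
    fin_cases i <;> fin_cases j <;> simp [A, B, Matrix.mul_apply, Fin.sum_univ_two] <;>
      first | ring1 | linear_combination h | linear_combination -h
  · have h1 := congrFun (congrFun h 1) 0
    simp [C, D, Matrix.mul_apply, Fin.sum_univ_two] at h1
    linear_combination h1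
  · ext i j
    fin_cases i <;> fin_cases j <;> simp [C, D, Matrix.mul_apply, Fin.sum_univ_two] <;>
      first | ring1 | linear_combination h | linear_combination -h
  · have h1 := congrFun (congrFun h 0) 0
    simp [A, B, C, D, Matrix.mul_apply, Fin.sum_univ_two] at h1
    linear_combination h1
  · ext i j
    fin_cases i <;> fin_cases j <;> simp [A, B, C, D, Matrix.mul_apply, Fin.sum_univ_two] <;>
      first | ring1 | linear_combination h | linear_combination -h
  · rw [Matrix.det_fin_two_of]
    constructor <;> intro h <;> linear_combination h
end

section
/- Let q ∈ ℂ, q ≠ 0, and let I ⊆ F be the two-sided ideal generated by x·y − q⁻¹·(y·x). Let A, B, C, D ∈ M₂(ℂ), T₁ = L(A,B) and T₂ = L(C,D) in M₂(F). Then every entry of the matrix T₁·T₂ − q⁻¹·(T₂·T₁) lies in I if and only if A·C = q⁻¹·(C·A), B·D = q⁻¹·(D·B), and A·D − D·A + q·(B·C) − q⁻¹·(C·B) = 0. -/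
noncomputable section

/-- The two-sided ideal of the quantum plane relation `x·y − q⁻¹·(y·x)`. -/
def quantumPlaneIdeal (q : ℂ) : TwoSidedIdeal F2 :=
  TwoSidedIdeal.span {xg * yg - q⁻¹ • (yg * xg)}

theorem qp_mem_iff (q : ℂ) (hq : q ≠ 0) (a b c d : ℂ) :
    a • (xg * xg) + b • (xg * yg) + c • (yg * xg) + d • (yg * yg) ∈ quantumPlaneIdeal q ↔
      a = 0 ∧ d = 0 ∧ b + q * c = 0 := by
  constructor
  · intro h
    have key : ∀ {R : Type} [Ring R] [Algebra ℂ R] (X Y : R), X * Y = q⁻¹ • (Y * X) →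
        a • (X * X) + b • (X * Y) + c • (Y * X) + d • (Y * Y) = 0 := by
      intro R _ _ X Y hXY
      let f : F2 →ₐ[ℂ] R := FreeAlgebra.lift ℂ ![X, Y]
      have hx : f xg = X := by simp [f, xg]
      have hy : f yg = Y := by simp [f, yg]
      have hle : quantumPlaneIdeal q ≤ TwoSidedIdeal.ker f := by
        unfold quantumPlaneIdeal
        rw [TwoSidedIdeal.span_le]
        rintro _ rfl
        simp [TwoSidedIdeal.mem_ker, hx, hy, hXY]
      have := hle h
      simpa [TwoSidedIdeal.mem_ker, hx, hy] using this
    have ha : a = 0 := by simpa using key (1 : ℂ) 0 (by simp)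
    have hd : d = 0 := by simpa using key (0 : ℂ) 1 (by simp)
    refine ⟨ha, hd, ?_⟩
    have h3 := key (R := Matrix (Fin 3) (Fin 3) ℂ) !![0, 1, 0; 0, 0, 1; 0, 0, 0]
      !![0, 1, 0; 0, 0, q⁻¹; 0, 0, 0] (by
        ext i j
        fin_cases i <;> fin_cases j <;> simp [Matrix.mul_apply, Fin.sum_univ_three])
    have h4 := congrFun (congrFun h3 0) 2
    simp [Matrix.mul_apply, Fin.sum_univ_three, ha, hd] at h4
    field_simp at h4
    linear_combination h4
  · rintro ⟨rfl, rfl, h⟩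
    have hb : b = -(q * c) := by linear_combination h
    have h1 : xg * yg - q⁻¹ • (yg * xg) ∈ quantumPlaneIdeal q :=
      TwoSidedIdeal.subset_span rfl
    have h2 := (quantumPlaneIdeal q).mul_mem_left (algebraMap ℂ F2 b) _ h1
    rw [← Algebra.smul_def] at h2
    convert h2 using 1
    have : b * q⁻¹ = -c := by rw [hb]; field_simp
    rw [smul_sub, smul_smul, this]
    simp

theorem qp_entry (q : ℂ) (A B C D : Matrix (Fin 2) (Fin 2) ℂ) (i j : Fin 2) :
    (L A B * L C D - q⁻¹ • (L C D * L A B)) i j =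
      (A * C - q⁻¹ • (C * A)) i j • (xg * xg) + (A * D - q⁻¹ • (C * B)) i j • (xg * yg)
      + (B * C - q⁻¹ • (D * A)) i j • (yg * xg) + (B * D - q⁻¹ • (D * B)) i j • (yg * yg) := by
  simp only [Matrix.sub_apply, Matrix.smul_apply, Matrix.mul_apply, Fin.sum_univ_two, L,
    add_mul, mul_add, smul_mul_assoc, mul_smul_comm, smul_eq_mul]
  module

/-- For `T₁ = L A B`, `T₂ = L C D`, every entry of `T₁·T₂ − q⁻¹·(T₂·T₁)` lies in the
quantum-plane ideal iff `A·C = q⁻¹·(C·A)`, `B·D = q⁻¹·(D·B)` and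
`A·D − D·A + q·(B·C) − q⁻¹·(C·B) = 0`. -/
theorem quantumPlane_consistency_iff (q : ℂ) (hq : q ≠ 0)
    (A B C D : Matrix (Fin 2) (Fin 2) ℂ) :
    (∀ i j, (L A B * L C D - q⁻¹ • (L C D * L A B)) i j ∈ quantumPlaneIdeal q) ↔
      A * C = q⁻¹ • (C * A) ∧ B * D = q⁻¹ • (D * B) ∧
        A * D - D * A + q • (B * C) - q⁻¹ • (C * B) = 0 := by
  simp only [qp_entry, qp_mem_iff q hq]
  constructor
  · intro h
    refine ⟨?_, ?_, ?_⟩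
    · ext i j
      exact sub_eq_zero.mp (h i j).1
    · ext i j
      exact sub_eq_zero.mp (h i j).2.1
    · ext i j
      have := (h i j).2.2
      simp only [Matrix.sub_apply, Matrix.add_apply, Matrix.smul_apply, smul_eq_mul,
        Matrix.zero_apply] at this ⊢
      linear_combination this + (D * A) i j * (mul_inv_cancel₀ hq)
  · rintro ⟨h1, h2, h3⟩ i j
    refine ⟨by rw [h1]; simp, by rw [h2]; simp, ?_⟩
    have := congrFun (congrFun h3 i) j
    simp only [Matrix.sub_apply, Matrix.add_apply, Matrix.smul_apply, smul_eq_mul,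
      Matrix.zero_apply] at this ⊢
    linear_combination this - (D * A) i j * (mul_inv_cancel₀ hq)
end
end

section
/- Let q ∈ ℂ, q ≠ 0, and let I ⊆ F be the two-sided ideal generated by x·y − q⁻¹·(y·x). Then the images of x·x, y·y and x·y under the quotient map F → F/I are linearly independent over ℂ. -/
noncomputable section

/-- The quantum plane relation `x·y = q⁻¹·(y·x)`; quotienting the free algebra by it
is the quotient by the two-sided ideal generated by `x·y − q⁻¹·(y·x)`. -/
inductive qpRel (q : ℂ) : F2 → F2 → Prop
  | rel : qpRel q (xg * yg) (q⁻¹ • (yg * xg))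

/-- The quantum plane `H₂ = ℂ⟨x,y⟩/(xy − q⁻¹yx)`. -/
abbrev QuantumPlane (q : ℂ) : Type := RingQuot (qpRel q)

/-- The quotient map. -/
def π (q : ℂ) : F2 →ₐ[ℂ] QuantumPlane q := RingQuot.mkAlgHom ℂ (qpRel q)

/-- Any pair satisfying the relation gives an algebra map out of the quantum plane. -/
theorem qp_exists_hom (q : ℂ) {A : Type} [Ring A] [Algebra ℂ A] (X Y : A)
    (h : X * Y = q⁻¹ • (Y * X)) :
    ∃ f : QuantumPlane q →ₐ[ℂ] A, f (π q xg) = X ∧ f (π q yg) = Y := by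
  have hr : ∀ ⦃a b : F2⦄, qpRel q a b →
      FreeAlgebra.lift ℂ (![X, Y] : Fin 2 → A) a = FreeAlgebra.lift ℂ (![X, Y] : Fin 2 → A) b := by
    rintro _ _ ⟨⟩
    simpa [xg, yg] using h
  refine ⟨RingQuot.liftAlgHom ℂ ⟨FreeAlgebra.lift ℂ (![X, Y] : Fin 2 → A), hr⟩, ?_, ?_⟩
  · simp [π, xg]
  · simp [π, yg]

/-- The images of `x·x`, `y·y` and `x·y` in the quantum plane are linearly
independent over `ℂ`. -/
theorem quantumPlane_quadratic_linearIndependent (q : ℂ) (hq : q ≠ 0) :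
    LinearIndependent ℂ
      (![π q (xg * xg), π q (yg * yg), π q (xg * yg)] : Fin 3 → QuantumPlane q) := by
  rw [Fintype.linearIndependent_iff]
  intro g hg
  simp only [Fin.sum_univ_three, Matrix.cons_val_zero, Matrix.cons_val_one, Matrix.cons_val,
    map_mul] at hg
  have h0 : g 0 = 0 := by
    obtain ⟨f, hx, hy⟩ := qp_exists_hom q (1 : ℂ) 0 (by simp)
    simpa [hx, hy] using congrArg f hg
  have h1 : g 1 = 0 := by
    obtain ⟨f, hx, hy⟩ := qp_exists_hom q (0 : ℂ) 1 (by simp)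
    simpa [hx, hy] using congrArg f hg
  have h2 : g 2 = 0 := by
    obtain ⟨f, hx, hy⟩ := qp_exists_hom q (!![0, 1, 0; 0, 0, 1; 0, 0, 0] : Matrix (Fin 3) (Fin 3) ℂ)
      !![0, q, 0; 0, 0, 1; 0, 0, 0] (by
        ext i j
        fin_cases i <;> fin_cases j <;> simp [Matrix.mul_apply, Fin.sum_univ_three, hq])
    have := congrArg f hg
    simp only [h0, h1, zero_smul, zero_add, map_smul, map_mul, hx, hy, map_zero] at this
    simpa [Matrix.mul_apply, Fin.sum_univ_three] using congrFun (congrFun this 0) 2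
  intro i
  fin_cases i
  · exact h0
  · exact h1
  · exact h2
end
end

section
/- Let μ, λ ∈ ℂ, let F = FreeAlgebra ℂ (Fin 2) with generators x, y, let I be the two-sided ideal generated by x·y and y·x, and let T : F → M₂(F) be the unique ℂ-algebra homomorphism with T(x) = [[μ·y, −y],[0, 0]] and T(y) = [[0, 0],[−x, λ·x]]. Then T maps I into M₂(I): for every f ∈ I, every entry of the matrix T(f) lies in I. (This is the T-consistency of the ideal (x¹x², x²x¹) for the commutation rules x¹·dx¹ = dx¹·μx², x¹·dx² = −dx¹·x², x²·dx¹ = −dx²·x¹, x²·dx² = dx²·λx¹.) -/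
noncomputable section

/-- The two-sided ideal generated by `x·y` and `y·x`. -/
def xyIdeal : TwoSidedIdeal F2 := TwoSidedIdeal.span {xg * yg, yg * xg}

/-- The unique `ℂ`-algebra homomorphism `T : F → M₂(F)` with
`T x = [[μ·y, −y],[0, 0]]` and `T y = [[0, 0],[−x, λ·x]]`, encoding the commutation
rules `x¹·dx¹ = dx¹·μx²`, `x¹·dx² = −dx¹·x²`, `x²·dx¹ = −dx²·x¹`,
`x²·dx² = dx²·λx¹`. -/
def Thom (μ lam : ℂ) : F2 →ₐ[ℂ] Matrix (Fin 2) (Fin 2) F2 :=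
  FreeAlgebra.lift ℂ ![!![μ • yg, -yg; 0, 0], !![0, 0; -xg, lam • xg]]

/-- T-consistency of the ideal `(x¹x², x²x¹)` for the commutation rules above:
`T` maps the ideal into `M₂` of the ideal. -/
theorem xyIdeal_T_consistent (μ lam : ℂ) :
    ∀ f ∈ xyIdeal, ∀ i j, Thom μ lam f i j ∈ xyIdeal := by
  have hxy : xg * yg ∈ xyIdeal := TwoSidedIdeal.subset_span (by simp)
  have hyx : yg * xg ∈ xyIdeal := TwoSidedIdeal.subset_span (by simp)
  have hs : ∀ (c : ℂ) (a : F2), a ∈ xyIdeal → c • a ∈ xyIdeal := by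
    intro c a ha
    rw [Algebra.smul_def]
    exact xyIdeal.mul_mem_left _ _ ha
  have hTx : Thom μ lam xg = !![μ • yg, -yg; 0, 0] := by
    simp [Thom, xg, FreeAlgebra.lift_ι_apply]
  have hTy : Thom μ lam yg = !![0, 0; -xg, lam • xg] := by
    simp [Thom, yg, FreeAlgebra.lift_ι_apply]
  have key : xyIdeal ≤ TwoSidedIdeal.comap (Thom μ lam) (TwoSidedIdeal.matrix (Fin 2) xyIdeal) := by
    conv_lhs => rw [xyIdeal]
    rw [TwoSidedIdeal.span_le]
    rintro f (rfl | rfl)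
    · rw [SetLike.mem_coe, TwoSidedIdeal.mem_comap, TwoSidedIdeal.mem_matrix, map_mul, hTx, hTy]
      intro i j
      fin_cases i <;> fin_cases j <;>
        simp [Matrix.mul_apply, Fin.sum_univ_two, hyx, hs, xyIdeal.zero_mem, xyIdeal.neg_mem]
    · rw [SetLike.mem_coe, TwoSidedIdeal.mem_comap, TwoSidedIdeal.mem_matrix, map_mul, hTx, hTy]
      intro i j
      fin_cases i <;> fin_cases j <;>
        simp [Matrix.mul_apply, Fin.sum_univ_two, hxy, hs, xyIdeal.zero_mem, xyIdeal.neg_mem]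
  intro f hf i j
  have := key hf
  rw [TwoSidedIdeal.mem_comap, TwoSidedIdeal.mem_matrix] at this
  exact this i j
end
end

section
/- Let n ∈ ℕ, let q : Fin n → Fin n → ℂ satisfy q i j · q j i = 1 for all i ≠ j, let F = FreeAlgebra ℂ (Fin n) with generators x_i, let I be the two-sided ideal generated by the elements q i j · (x_i · x_j) − x_j · x_i for i < j, and let T : F → Matrix (Fin n) (Fin n) F be the unique ℂ-algebra homomorphism sending x_j to the diagonal matrix whose (i,i) entry is q i j · x_j (and off-diagonal entries zero). Then T maps I into Mₙ(I): for every f ∈ I, every entry of T(f) lies in I. (This is the T-consistency of the relation ideal for the diagonal commutation rules x^j·dx^i = dx^i·q^{ij}x^j.) -/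
noncomputable section

/-- T-consistency of the relation ideal for the diagonal commutation rules
`x^j·dx^i = dx^i·q^{ij}·x^j`: if `q i j · q j i = 1` for `i ≠ j`, then the unique
`ℂ`-algebra homomorphism `T` sending `x j` to the diagonal matrix with `(i,i)` entry
`q i j • x j` maps the two-sided ideal generated by the elements
`q i j • (x i * x j) − x j * x i` (`i < j`) into `Mₙ` of that ideal. -/
theorem diagonal_commutation_T_consistent (n : ℕ) (q : Fin n → Fin n → ℂ)
    (hq : ∀ i j : Fin n, i ≠ j → q i j * q j i = 1) :
    let F := FreeAlgebra ℂ (Fin n)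
    let x : Fin n → F := FreeAlgebra.ι ℂ
    let I : TwoSidedIdeal F :=
      TwoSidedIdeal.span {f | ∃ i j : Fin n, i < j ∧ f = q i j • (x i * x j) - x j * x i}
    let T : F →ₐ[ℂ] Matrix (Fin n) (Fin n) F :=
      FreeAlgebra.lift ℂ fun j => Matrix.diagonal fun i => q i j • x j
    ∀ f ∈ I, ∀ k l, T f k l ∈ I := by
  intro F x I T f hf
  have hsum : ∀ (g : Fin n → F), (∀ m, g m ∈ I) → ∑ m, g m ∈ I := fun g hg =>
    sum_mem fun m _ => hg m
  have hT : ∀ j, T (x j) = Matrix.diagonal fun i => q i j • x j := fun j =>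
    FreeAlgebra.lift_ι_apply _ _
  induction hf using TwoSidedIdeal.span_induction with
  | mem f hf =>
    obtain ⟨i, j, hij, rfl⟩ := hf
    intro k l
    have h0 : q i j • (x i * x j) - x j * x i ∈ I :=
      TwoSidedIdeal.subset_span ⟨i, j, hij, rfl⟩
    rw [map_sub, map_smul, map_mul, map_mul, hT, hT, Matrix.diagonal_mul_diagonal,
      Matrix.diagonal_mul_diagonal, Matrix.sub_apply, Matrix.smul_apply]
    by_cases hkl : k = l
    · subst hkl
      rw [Matrix.diagonal_apply_eq, Matrix.diagonal_apply_eq]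
      have h1 := I.mul_mem_left (algebraMap ℂ F (q k i * q k j)) _ h0
      rw [← Algebra.smul_def] at h1
      convert h1 using 1
      simp only [smul_mul_assoc, mul_smul_comm, smul_sub, smul_smul]
      congr 2 <;> ring
    · rw [Matrix.diagonal_apply_ne _ hkl, Matrix.diagonal_apply_ne _ hkl, smul_zero, sub_zero]
      exact I.zero_mem
  | zero => intro k l; rw [map_zero]; exact I.zero_mem
  | add a b _ _ ha hb =>
    intro k l; rw [map_add]; exact I.add_mem (ha k l) (hb k l)
  | neg a _ ha => intro k l; rw [map_neg]; exact I.neg_mem (ha k l)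
  | left_absorb a b _ hb =>
    intro k l; rw [map_mul, Matrix.mul_apply]
    exact hsum _ fun m => I.mul_mem_left _ _ (hb m l)
  | right_absorb a b _ hb =>
    intro k l; rw [map_mul, Matrix.mul_apply]
    exact hsum _ fun m => I.mul_mem_right _ _ (hb k m)
end
end
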